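/- arXiv:2406.14078 — 2 statements merged into one kernel-verified Lean document; each statement's English description precedes it below -/
import Mathlib

section
/- Let n ≥ 2, fix numbers m, d ≥ 2 of inputs and outcomes per party, and fix k with 1 ≤ k ≤ n. Let G be a finite family of subsets g ⊆ {1,…,n} with |g| ≥ 2, and for each g ∈ G let I^g be a Bell expression such that (i) for every bipartition S|S̄ of {1,…,n} and every n-partite correlation p that is local across S|S̄, if there exist i, j ∈ g with i ∈ S and j ∈ S̄ then I^g(p) ≤ 0, and (ii) all the I^g have the same positive part I₊. Let T be a Bell expression with nonnegative coefficients such that, coefficientwise, T ≤ I₋^g for every g ∈ G. Set γ_k = max over partitions {S_1,…,S_L} of {1,…,n} into disjoint nonempty blocks of size at most k of |{g ∈ G : g ⊆ S_l for some l}|. Then every k-producible n-partite correlation p satisfies ∑_{g∈G} I^g(p) ≤ γ_k·(I₊(p) − T(p)). -/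
/-- A non-signaling correlation with `d` outcomes and `m` inputs per party, for a
finite set `ι` of parties: nonnegative, normalized, and non-signaling. -/
def IsNSCorr {ι : Type} [Fintype ι] [DecidableEq ι] (d m : ℕ)
    (p : (ι → Fin d) → (ι → Fin m) → ℝ) : Prop :=
  (∀ a x, 0 ≤ p a x) ∧ (∀ x, ∑ a : ι → Fin d, p a x = 1) ∧
  (∀ (i : ι) (a : ι → Fin d) (x x' : ι → Fin m), (∀ j, j ≠ i → x j = x' j) →
    ∑ v : Fin d, p (Function.update a i v) x = ∑ v : Fin d, p (Function.update a i v) x')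

/-- `p` is local across the bipartition `S | Sᶜ` of the `n` parties. -/
def IsLocalAcross (n d m : ℕ) (S : Finset (Fin n))
    (p : (Fin n → Fin d) → (Fin n → Fin m) → ℝ) : Prop :=
  ∃ (N : ℕ) (q : Fin N → ℝ)
    (pS : Fin N → ({i : Fin n // i ∈ S} → Fin d) → ({i : Fin n // i ∈ S} → Fin m) → ℝ)
    (pT : Fin N → ({i : Fin n // i ∉ S} → Fin d) → ({i : Fin n // i ∉ S} → Fin m) → ℝ),
    (∀ l, 0 ≤ q l) ∧ (∑ l, q l = 1) ∧
    (∀ l, IsNSCorr d m (pS l)) ∧ (∀ l, IsNSCorr d m (pT l)) ∧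
    (∀ a x, p a x =
      ∑ l, q l * pS l (fun i => a i.1) (fun i => x i.1) * pT l (fun i => a i.1) (fun i => x i.1))

/-- `p` is bilocal: a convex combination of correlations, each local across some
nontrivial bipartition. -/
def IsBilocal (n d m : ℕ) (p : (Fin n → Fin d) → (Fin n → Fin m) → ℝ) : Prop :=
  ∃ (N : ℕ) (q : Fin N → ℝ)
    (ps : Fin N → (Fin n → Fin d) → (Fin n → Fin m) → ℝ) (S : Fin N → Finset (Fin n)),
    (∀ l, 0 ≤ q l) ∧ (∑ l, q l = 1) ∧
    (∀ l, (S l).Nonempty ∧ S l ≠ Finset.univ ∧ IsLocalAcross n d m (S l) (ps l)) ∧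
    (∀ a x, p a x = ∑ l, q l * ps l a x)

/-- `p` is a mixture of products over the blocks (the fibers) of the partition
function `π`. -/
def IsProdForPartition (n d m : ℕ) (π : Fin n → Fin n)
    (p : (Fin n → Fin d) → (Fin n → Fin m) → ℝ) : Prop :=
  ∃ (N : ℕ) (q : Fin N → ℝ)
    (pB : Fin N → (t : Fin n) →
      ({i : Fin n // π i = t} → Fin d) → ({i : Fin n // π i = t} → Fin m) → ℝ),
    (∀ l, 0 ≤ q l) ∧ (∑ l, q l = 1) ∧
    (∀ l t, IsNSCorr d m (pB l t)) ∧
    (∀ a x, p a x = ∑ l, q l * ∏ t : Fin n, pB l t (fun i => a i.1) (fun i => x i.1))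

/-- `p` is `k`-producible: a convex combination of correlations, each a mixture of
products over the blocks of a partition of the parties into blocks of size at most `k`. -/
def IsKProducible (n d m k : ℕ) (p : (Fin n → Fin d) → (Fin n → Fin m) → ℝ) : Prop :=
  ∃ (N : ℕ) (q : Fin N → ℝ)
    (ps : Fin N → (Fin n → Fin d) → (Fin n → Fin m) → ℝ) (π : Fin N → (Fin n → Fin n)),
    (∀ l, 0 ≤ q l) ∧ (∑ l, q l = 1) ∧
    (∀ l, (∀ t, (Finset.univ.filter (fun i => π l i = t)).card ≤ k) ∧
      IsProdForPartition n d m (π l) (ps l)) ∧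
    (∀ a x, p a x = ∑ l, q l * ps l a x)

/-- The value of the Bell expression with coefficients `β` on the correlation `p`. -/
def BellApply {n d m : ℕ} (β : (Fin n → Fin d) → (Fin n → Fin m) → ℝ)
    (p : (Fin n → Fin d) → (Fin n → Fin m) → ℝ) : ℝ :=
  ∑ a, ∑ x, β a x * p a x

/-- The product, over the labels satisfying `Q`, of non-signaling correlations on the fibers
of `π` is a non-signaling correlation on the parties whose label satisfies `Q`. -/
theorem IsNSCorr.prod_fibers {ι κ : Type} [Fintype ι] [DecidableEq ι] [Fintype κ]
    [DecidableEq κ] {d m : ℕ} (π : ι → κ) (Q : κ → Prop) [DecidablePred Q]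
    (R : ι → Prop) [Fintype {i : ι // R i}] (hR : ∀ i, R i ↔ Q (π i))
    (pB : (t : κ) → ({i : ι // π i = t} → Fin d) → ({i : ι // π i = t} → Fin m) → ℝ)
    (hB : ∀ t, IsNSCorr d m (pB t)) :
    IsNSCorr d m (fun (a : {i : ι // R i} → Fin d) (x : {i : ι // R i} → Fin m) =>
      ∏ t : {t : κ // Q t},
        pB t (fun b => a ⟨b.1, (hR b.1).2 (b.2.symm ▸ t.2)⟩)
          (fun b => x ⟨b.1, (hR b.1).2 (b.2.symm ▸ t.2)⟩)) := by
  refine ⟨fun a x => Finset.prod_nonneg fun t _ => (hB t).1 _ _, fun x => ?_,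
    fun i a x x' hx => ?_⟩
  · let e : ({i : ι // R i} → Fin d) ≃
        ((t : {t : κ // Q t}) → {i : ι // π i = t.1} → Fin d) :=
      { toFun := fun a t b => a ⟨b.1, (hR b.1).2 (b.2.symm ▸ t.2)⟩
        invFun := fun a i => a ⟨π i.1, (hR i.1).1 i.2⟩ ⟨i.1, rfl⟩
        left_inv := fun a => rfl
        right_inv := fun a => funext fun ⟨t, ht⟩ => funext fun ⟨b, hb⟩ => by
          cases hb
          rfl }
    have hsum := e.sum_comp (fun a' => ∏ t : {t : κ // Q t},
      pB t (a' t) (fun b => x ⟨b.1, (hR b.1).2 (b.2.symm ▸ t.2)⟩))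
    refine hsum.trans ?_
    rw [← Fintype.piFinset_univ]
    refine (Finset.prod_univ_sum _ fun (t : {t : κ // Q t}) a' =>
      pB t a' (fun b => x ⟨b.1, (hR b.1).2 (b.2.symm ▸ t.2)⟩)).symm.trans ?_
    exact Finset.prod_eq_one fun t _ => (hB t).2.1 _
  · let t₀ : {t : κ // Q t} := ⟨π i.1, (hR i.1).1 i.2⟩
    simp only [Fintype.prod_eq_mul_prod_compl t₀]
    have hrest (v : Fin d) (y : {i : ι // R i} → Fin m) (hy : ∀ j, j ≠ i → x j = y j) :
        ∏ t ∈ ({t₀}ᶜ : Finset {t : κ // Q t}),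
          pB t (fun b => Function.update a i v ⟨b.1, (hR b.1).2 (b.2.symm ▸ t.2)⟩)
            (fun b => y ⟨b.1, (hR b.1).2 (b.2.symm ▸ t.2)⟩) =
        ∏ t ∈ ({t₀}ᶜ : Finset {t : κ // Q t}),
          pB t (fun b => a ⟨b.1, (hR b.1).2 (b.2.symm ▸ t.2)⟩)
            (fun b => x ⟨b.1, (hR b.1).2 (b.2.symm ▸ t.2)⟩) := by
      refine Finset.prod_congr rfl fun t ht => ?_
      have hne (b : {j : ι // π j = t.1}) :
          (⟨b.1, (hR b.1).2 (b.2.symm ▸ t.2)⟩ : {j : ι // R j}) ≠ i := by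
        rintro rfl
        exact Finset.mem_compl.1 ht (Finset.mem_singleton.2 (Subtype.ext b.2.symm))
      congr 1
      · exact funext fun b => Function.update_of_ne (hne b) _ _
      · exact funext fun b => (hy _ (hne b)).symm
    simp only [hrest _ x (fun _ _ => rfl), hrest _ x' hx, ← Finset.sum_mul]
    congr 1
    have hupd (v : Fin d) :
        (fun b : {j : ι // π j = t₀.1} =>
          Function.update a i v ⟨b.1, (hR b.1).2 (b.2.symm ▸ t₀.2)⟩) =
        Function.update (fun b : {j : ι // π j = t₀.1} =>
          a ⟨b.1, (hR b.1).2 (b.2.symm ▸ t₀.2)⟩) ⟨i.1, rfl⟩ v := by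
      funext b
      by_cases hb : b = ⟨i.1, rfl⟩
      · subst hb
        simp
      · rw [Function.update_of_ne hb, Function.update_of_ne]
        exact fun h => hb (Subtype.ext (congrArg (fun j => j.1) h))
    simp only [hupd]
    refine (hB t₀).2.2 ⟨i.1, rfl⟩ _ _ _ fun b hb => hx _ fun h => hb ?_
    exact Subtype.ext (congrArg (fun j => j.1) h)

theorem IsProdForPartition.nonneg {n d m : ℕ} {π : Fin n → Fin n}
    {p : (Fin n → Fin d) → (Fin n → Fin m) → ℝ} (h : IsProdForPartition n d m π p)
    (a : Fin n → Fin d) (x : Fin n → Fin m) : 0 ≤ p a x := by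
  obtain ⟨N, q, pB, hq, -, hB, hp⟩ := h
  rw [hp]
  exact Finset.sum_nonneg fun l _ => mul_nonneg (hq l)
    (Finset.prod_nonneg fun t _ => (hB l t).1 _ _)

/-- A mixture of products over the fibers of `π` is local across each fiber and its
complement. -/
theorem IsProdForPartition.isLocalAcross {n d m : ℕ} {π : Fin n → Fin n}
    {p : (Fin n → Fin d) → (Fin n → Fin m) → ℝ} (h : IsProdForPartition n d m π p)
    (t : Fin n) : IsLocalAcross n d m (Finset.univ.filter (fun i => π i = t)) p := by
  obtain ⟨N, q, pB, hq, hq1, hB, hp⟩ := h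
  have hS (i : Fin n) : i ∈ Finset.univ.filter (fun i => π i = t) ↔ π i = t := by simp
  refine ⟨N, q, _, _, hq, hq1,
    fun l => IsNSCorr.prod_fibers π (fun s => s = t)
      (fun i => i ∈ Finset.univ.filter (fun i => π i = t)) hS (pB l) (hB l),
    fun l => IsNSCorr.prod_fibers π (fun s => ¬ s = t)
      (fun i => i ∉ Finset.univ.filter (fun i => π i = t)) (fun i => not_congr (hS i))
      (pB l) (hB l), fun a x => ?_⟩
  rw [hp]
  refine Finset.sum_congr rfl fun l _ => ?_
  rw [mul_assoc]
  congr 1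
  exact (Fintype.prod_subtype_mul_prod_subtype (fun s => s = t)
    (fun s => pB l s (fun i => a i.1) (fun i => x i.1))).symm

theorem BellApply_sum {n d m N : ℕ} (β : (Fin n → Fin d) → (Fin n → Fin m) → ℝ)
    {p : (Fin n → Fin d) → (Fin n → Fin m) → ℝ} {q : Fin N → ℝ}
    {ps : Fin N → (Fin n → Fin d) → (Fin n → Fin m) → ℝ}
    (hp : ∀ a x, p a x = ∑ l, q l * ps l a x) :
    BellApply β p = ∑ l, q l * BellApply β (ps l) := by
  simp only [BellApply, hp, Finset.mul_sum]
  rw [Finset.sum_comm (s := (Finset.univ : Finset (Fin N)))]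
  refine Finset.sum_congr rfl fun a _ => ?_
  rw [Finset.sum_comm (s := (Finset.univ : Finset (Fin N)))]
  exact Finset.sum_congr rfl fun x _ => Finset.sum_congr rfl fun l _ => by ring

/-- If every `f g` is at most `D`, and nonpositive outside a subfamily of size `c`, then the
sum of `f` is at most `γ * D` for every `γ` between `c` and the size of the whole family. -/
theorem Finset.sum_le_natCast_mul_of_le_of_nonpos {α : Type*} (G : Finset α)
    (P : α → Prop) [DecidablePred P] (f : α → ℝ) (D : ℝ) (γ : ℕ)
    (hD : ∀ g ∈ G, f g ≤ D) (h0 : ∀ g ∈ G, ¬ P g → f g ≤ 0)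
    (hc : (G.filter P).card ≤ γ) (hγ : γ ≤ G.card) :
    ∑ g ∈ G, f g ≤ γ * D := by
  rcases le_total 0 D with hD0 | hD0
  · calc ∑ g ∈ G, f g = ∑ g ∈ G with P g, f g + ∑ g ∈ G with ¬ P g, f g :=
          (Finset.sum_filter_add_sum_filter_not G P f).symm
      _ ≤ ∑ g ∈ G with P g, f g := by
          refine add_le_of_nonpos_right (Finset.sum_nonpos fun g hg => ?_)
          exact h0 g (Finset.mem_filter.1 hg).1 (Finset.mem_filter.1 hg).2
      _ ≤ (G.filter P).card * D := by
          rw [← nsmul_eq_mul]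
          exact Finset.sum_le_card_nsmul _ _ _ fun g hg => hD g (Finset.mem_filter.1 hg).1
      _ ≤ γ * D := by gcongr
  · calc ∑ g ∈ G, f g ≤ G.card * D := by
          rw [← nsmul_eq_mul]
          exact Finset.sum_le_card_nsmul _ _ _ hD
      _ ≤ γ * D := mul_le_mul_of_nonpos_right (by exact_mod_cast hγ) hD0

/-- Under the same assumptions on the family `I^g = β g` and on `T`,
every `k`-producible correlation `p` satisfies `∑_{g ∈ G} I^g(p) ≤ γₖ (I₊(p) - T(p))`,
where `γₖ` is the maximum, over partitions of the parties (encoded as fibers of a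
function `π : Fin n → Fin n`) into blocks of size at most `k`, of the number of
`g ∈ G` contained in a single block. -/
theorem statement2 (n m d k : ℕ) (hn : 2 ≤ n) (hm : 2 ≤ m) (hd : 2 ≤ d)
    (hk : 1 ≤ k) (hkn : k ≤ n)
    (G : Finset (Finset (Fin n))) (hG : ∀ g ∈ G, 2 ≤ g.card)
    (β : Finset (Fin n) → (Fin n → Fin d) → (Fin n → Fin m) → ℝ)
    (Iplus : (Fin n → Fin d) → (Fin n → Fin m) → ℝ)
    (hIplus : ∀ g ∈ G, ∀ a x, max (β g a x) 0 = Iplus a x)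
    (hloc : ∀ g ∈ G, ∀ S : Finset (Fin n), S.Nonempty → S ≠ Finset.univ →
      ∀ p : (Fin n → Fin d) → (Fin n → Fin m) → ℝ, IsLocalAcross n d m S p →
        (∃ i ∈ g, i ∈ S) → (∃ j ∈ g, j ∉ S) → BellApply (β g) p ≤ 0)
    (T : (Fin n → Fin d) → (Fin n → Fin m) → ℝ)
    (hT0 : ∀ a x, 0 ≤ T a x)
    (hT : ∀ g ∈ G, ∀ a x, T a x ≤ max (-(β g a x)) 0)
    (p : (Fin n → Fin d) → (Fin n → Fin m) → ℝ)
    (hp : IsKProducible n d m k p) :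
    ∑ g ∈ G, BellApply (β g) p ≤
      (((Finset.univ.filter
            (fun π : Fin n → Fin n =>
              ∀ t, (Finset.univ.filter (fun i => π i = t)).card ≤ k)).sup
          (fun π => (G.filter
            (fun g => ∃ t, g ⊆ Finset.univ.filter (fun i => π i = t))).card) : ℕ) : ℝ) *
        (BellApply Iplus p - BellApply T p) := by
  obtain ⟨N, q, ps, π, hq, -, hps, hp⟩ := hp
  simp only [BellApply_sum _ hp]
  rw [Finset.sum_comm, ← Finset.sum_sub_distrib, Finset.mul_sum]
  refine Finset.sum_le_sum fun l _ => ?_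
  obtain ⟨hcard, hprod⟩ := hps l
  rw [← Finset.mul_sum, ← mul_sub, mul_left_comm]
  refine mul_le_mul_of_nonneg_left ?_ (hq l)
  refine Finset.sum_le_natCast_mul_of_le_of_nonpos G
    (fun g => ∃ t, g ⊆ Finset.univ.filter (fun i => π l i = t)) _ _ _
    (fun g hg => ?_) (fun g hg hnot => ?_) ?_ ?_
  · simp only [BellApply, ← Finset.sum_sub_distrib, ← sub_mul]
    refine Finset.sum_le_sum fun a _ => Finset.sum_le_sum fun x _ =>
      mul_le_mul_of_nonneg_right ?_ (hprod.nonneg a x)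
    have hβ := max_zero_sub_eq_self (β g a x)
    rw [max_comm (-(β g a x)), max_comm (β g a x)] at hβ
    have hp' := hIplus g hg a x
    have hT' := hT g hg a x
    rw [max_comm] at hp' hT'
    linarith
  · obtain ⟨i, hi⟩ : g.Nonempty := Finset.card_pos.1 (by have := hG g hg; omega)
    obtain ⟨j, hj, hjS⟩ := Finset.not_subset.1 (not_exists.1 hnot (π l i))
    have hiS : i ∈ Finset.univ.filter (fun i' => π l i' = π l i) := by simp
    exact hloc g hg _ ⟨i, hiS⟩ (fun h => hjS (h.ge (Finset.mem_univ j))) _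
      (hprod.isLocalAcross (π l i)) ⟨i, hi, hiS⟩ ⟨j, hj, hjS⟩
  · exact Finset.le_sup (f := fun π : Fin n → Fin n => (G.filter
      (fun g => ∃ t, g ⊆ Finset.univ.filter (fun i => π i = t))).card)
      (Finset.mem_filter.2 ⟨Finset.mem_univ _, hcard⟩)
  · exact Finset.sup_le fun _ _ => Finset.card_filter_le _ _
end

section
/- Let n ≥ 3. Every bilocal n-partite correlation p with 2 inputs and 2 outcomes per party satisfies ∑_{j=2}^{n} I^{1,j}_{0|0}(p) ≤ (n−2)·[p(0|0) − p(e_1|e_1)], where 0 is the all-zero tuple and e_1 = (1,0,…,0). -/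
/-- The outcome/input tuple with a single `1` at position `i` and `0` elsewhere. -/
def unitVec (n : ℕ) (i : Fin n) : Fin n → Fin 2 :=
  Function.update (fun _ => 0) i 1

/-- The lifted CHSH expression `I^{i,j}_{0|0}(p) =
p(0|0) − p(eᵢ|eᵢ) − p(eⱼ|eⱼ) − p(0|eᵢ+eⱼ)`. -/
def chshLift {n : ℕ} (i j : Fin n) (p : (Fin n → Fin 2) → (Fin n → Fin 2) → ℝ) : ℝ :=
  p (fun _ => 0) (fun _ => 0) - p (unitVec n i) (unitVec n i)
    - p (unitVec n j) (unitVec n j)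
    - p (fun _ => 0) (Function.update (unitVec n i) j 1)

/-- Non-signaling at a single party bounds `p(0|0)` by `p(eᵢ|eᵢ) + p(0|eᵢ)`. -/
theorem IsNSCorr.zero_le_add {ι : Type} [Fintype ι] [DecidableEq ι]
    {p : (ι → Fin 2) → (ι → Fin 2) → ℝ} (hp : IsNSCorr 2 2 p) (i : ι) :
    p (fun _ => 0) (fun _ => 0) ≤
      p (Function.update (fun _ => 0) i 1) (Function.update (fun _ => 0) i 1) +
        p (fun _ => 0) (Function.update (fun _ => 0) i 1) := by
  obtain ⟨hpos, -, hns⟩ := hp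
  have h := hns i (fun _ => 0) (fun _ => 0) (Function.update (fun _ => 0) i 1)
    (fun j hj => by rw [Function.update_of_ne hj])
  have h0 : Function.update (fun _ : ι => (0 : Fin 2)) i 0 = fun _ => 0 :=
    Function.update_eq_self i (fun _ : ι => (0 : Fin 2))
  rw [Fin.sum_univ_two, Fin.sum_univ_two, h0] at h
  linarith [hpos (Function.update (fun _ => 0) i 1) (fun _ => 0)]

/-- Restricting a single-site modification to a subtype containing the site. -/
theorem restrict_update_of_pos {α β : Type} [DecidableEq α] {P : α → Prop}
    (f : α → β) {i : α} (h : P i) (b : β) :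
    (fun k : {k // P k} => Function.update f i b k.1) =
      Function.update (fun k : {k // P k} => f k.1) ⟨i, h⟩ b := by
  funext k
  simp only [Function.update_apply, Subtype.ext_iff]

/-- Restricting a single-site modification to a subtype avoiding the site. -/
theorem restrict_update_of_neg {α β : Type} [DecidableEq α] {P : α → Prop}
    (f : α → β) {i : α} (h : ¬ P i) (b : β) :
    (fun k : {k // P k} => Function.update f i b k.1) = fun k => f k.1 := by
  funext k
  have hk : k.1 ≠ i := fun e => h (e ▸ k.2)
  rw [Function.update_of_ne hk]

/-- The CHSH inequality in product form. -/
theorem chsh_product_le {s₀ s₁ s₂ t₀ t₁ t₂ : ℝ} (hs₀ : 0 ≤ s₀) (hs₁ : 0 ≤ s₁) (hs₂ : 0 ≤ s₂)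
    (ht₀ : 0 ≤ t₀) (ht₁ : 0 ≤ t₁) (ht₂ : 0 ≤ t₂) (hs : s₀ ≤ s₁ + s₂) (ht : t₀ ≤ t₁ + t₂) :
    s₀ * t₀ - s₁ * t₀ - s₀ * t₁ - s₂ * t₂ ≤ 0 := by
  rcases le_total t₀ t₁ with h | h
  · nlinarith [mul_nonneg hs₀ (sub_nonneg.2 h), mul_nonneg hs₁ ht₀, mul_nonneg hs₂ ht₂]
  · nlinarith [mul_nonneg (sub_nonneg.2 hs) (sub_nonneg.2 h), mul_nonneg hs₁ ht₁,
      mul_nonneg hs₂ (sub_nonneg.2 ht)]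

theorem chshLift_sum {n N : ℕ} (i j : Fin n) (q : Fin N → ℝ)
    (ps : Fin N → (Fin n → Fin 2) → (Fin n → Fin 2) → ℝ) :
    chshLift i j (fun a x => ∑ l, q l * ps l a x) = ∑ l, q l * chshLift i j (ps l) := by
  simp only [chshLift, mul_sub, Finset.sum_sub_distrib]

theorem chshLift_comm {n : ℕ} {i j : Fin n} (hij : i ≠ j)
    (p : (Fin n → Fin 2) → (Fin n → Fin 2) → ℝ) : chshLift i j p = chshLift j i p := by
  simp only [chshLift, unitVec, Function.update_comm hij]
  ring

theorem IsLocalAcross.nonneg {n : ℕ} {S : Finset (Fin n)}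
    {p : (Fin n → Fin 2) → (Fin n → Fin 2) → ℝ} (hp : IsLocalAcross n 2 2 S p)
    (a x : Fin n → Fin 2) : 0 ≤ p a x := by
  obtain ⟨N, q, pS, pT, hq, -, hS, hT, h⟩ := hp
  rw [h]
  exact Finset.sum_nonneg fun l _ =>
    mul_nonneg (mul_nonneg (hq l) ((hS l).1 _ _)) ((hT l).1 _ _)

/-- The lifted CHSH expression is nonpositive on correlations that are local across a
bipartition separating the two parties. -/
theorem IsLocalAcross.chshLift_nonpos {n : ℕ} {S : Finset (Fin n)}
    {p : (Fin n → Fin 2) → (Fin n → Fin 2) → ℝ} (hp : IsLocalAcross n 2 2 S p)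
    {i j : Fin n} (hi : i ∈ S) (hj : j ∉ S) : chshLift i j p ≤ 0 := by
  obtain ⟨N, q, pS, pT, hq, -, hS, hT, h⟩ := hp
  have hp' : p = fun a x => ∑ l, q l * (fun (a x : Fin n → Fin 2) =>
      pS l (fun i => a i.1) (fun i => x i.1) * pT l (fun i => a i.1) (fun i => x i.1)) a x := by
    funext a x
    simp only [h, mul_assoc]
  rw [hp', chshLift_sum i j q fun l (a x : Fin n → Fin 2) =>
    pS l (fun i => a i.1) (fun i => x i.1) * pT l (fun i => a i.1) (fun i => x i.1)]
  refine Finset.sum_nonpos fun l _ => mul_nonpos_of_nonneg_of_nonpos (hq l) ?_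
  have hi' : ¬ (i ∉ S) := not_not.2 hi
  simp only [chshLift, unitVec]
  rw [restrict_update_of_pos (P := (· ∈ S)) _ hi, restrict_update_of_neg (P := (· ∉ S)) _ hi',
    restrict_update_of_neg (P := (· ∈ S)) _ hj, restrict_update_of_pos (P := (· ∉ S)) _ hj,
    restrict_update_of_neg (P := (· ∈ S)) _ hj, restrict_update_of_pos (P := (· ∉ S)) _ hj,
    restrict_update_of_pos (P := (· ∈ S)) _ hi, restrict_update_of_neg (P := (· ∉ S)) _ hi']
  exact chsh_product_le ((hS l).1 _ _) ((hS l).1 _ _) ((hS l).1 _ _) ((hT l).1 _ _)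
    ((hT l).1 _ _) ((hT l).1 _ _) ((hS l).zero_le_add ⟨i, hi⟩) ((hT l).zero_le_add ⟨j, hj⟩)

/-- For a nontrivial bipartition, every party is separated from some other party, and the
corresponding lifted CHSH expression is nonpositive. -/
theorem IsLocalAcross.exists_chshLift_nonpos {n : ℕ} {S : Finset (Fin n)}
    {p : (Fin n → Fin 2) → (Fin n → Fin 2) → ℝ} (hp : IsLocalAcross n 2 2 S p)
    (hne : S.Nonempty) (huniv : S ≠ Finset.univ) (i : Fin n) :
    ∃ j, j ≠ i ∧ chshLift i j p ≤ 0 := by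
  by_cases hi : i ∈ S
  · obtain ⟨j, hj⟩ : ∃ j, j ∉ S := by
      by_contra! hall
      exact huniv (Finset.eq_univ_iff_forall.2 hall)
    exact ⟨j, fun e => hj (e ▸ hi), hp.chshLift_nonpos hi hj⟩
  · obtain ⟨j, hj⟩ := hne
    have hji : j ≠ i := fun e => hi (e ▸ hj)
    exact ⟨j, hji, chshLift_comm hji p ▸ hp.chshLift_nonpos hj hi⟩

/-- If one lifted CHSH expression is nonpositive, the others are bounded trivially. -/
theorem sum_chshLift_le {n : ℕ} {p : (Fin n → Fin 2) → (Fin n → Fin 2) → ℝ}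
    (hp : ∀ a x, 0 ≤ p a x) {i j : Fin n} (hji : j ≠ i) (hj : chshLift i j p ≤ 0) :
    ∑ k ∈ Finset.univ.erase i, chshLift i k p ≤
      ((n : ℝ) - 2) * (p (fun _ => 0) (fun _ => 0) - p (unitVec n i) (unitVec n i)) := by
  have hmem : j ∈ (Finset.univ : Finset (Fin n)).erase i := by simp [hji]
  have hcard : (((Finset.univ.erase i).erase j).card : ℝ) = (n : ℝ) - 2 := by
    have h1 := Finset.card_erase_add_one hmem
    have h2 := Finset.card_erase_add_one (Finset.mem_univ i)
    rw [Finset.card_univ, Fintype.card_fin] at h2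
    rw [eq_sub_iff_add_eq]
    norm_cast
    omega
  rw [← Finset.add_sum_erase _ _ hmem, ← hcard, ← nsmul_eq_mul]
  have hle := Finset.sum_le_card_nsmul ((Finset.univ.erase i).erase j)
    (fun k => chshLift i k p)
    (p (fun _ => 0) (fun _ => 0) - p (unitVec n i) (unitVec n i)) fun k _ => by
      simp only [chshLift]
      linarith [hp (unitVec n k) (unitVec n k),
        hp (fun _ => 0) (Function.update (unitVec n i) k 1)]
  linarith

/-- every bilocal `n`-partite correlation (2 inputs / 2 outcomes per
party, `n ≥ 3`) satisfies `∑_{j=2}^n I^{1,j}_{0|0}(p) ≤ (n−2)[p(0|0) − p(e₁|e₁)]`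
(party 1 is index 0). -/
theorem statement4 (n : ℕ) (hn : 3 ≤ n)
    (p : (Fin n → Fin 2) → (Fin n → Fin 2) → ℝ)
    (hp : IsBilocal n 2 2 p) :
    ∑ j ∈ Finset.univ.filter (fun j : Fin n => (j : ℕ) ≠ 0),
        chshLift (⟨0, by omega⟩ : Fin n) j p ≤
      ((n : ℝ) - 2) *
        (p (fun _ => 0) (fun _ => 0) -
          p (unitVec n ⟨0, by omega⟩) (unitVec n ⟨0, by omega⟩)) := by
  obtain ⟨N, q, ps, S, hq, -, hS, h⟩ := hp
  have hfilter : Finset.univ.filter (fun j : Fin n => (j : ℕ) ≠ 0) =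
      Finset.univ.erase (⟨0, by omega⟩ : Fin n) := by
    ext j
    simp [Fin.ext_iff]
  obtain rfl : p = fun a x => ∑ l, q l * ps l a x := funext₂ h
  simp only [hfilter, chshLift_sum]
  rw [Finset.sum_comm, ← Finset.sum_sub_distrib, Finset.mul_sum]
  refine Finset.sum_le_sum fun l _ => ?_
  obtain ⟨hne, huniv, hloc⟩ := hS l
  obtain ⟨j, hj0, hj⟩ := hloc.exists_chshLift_nonpos hne huniv ⟨0, by omega⟩
  rw [← Finset.mul_sum, ← mul_sub, mul_left_comm]
  exact mul_le_mul_of_nonneg_left (sum_chshLift_le hloc.nonneg hj0 hj) (hq l)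
end
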